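/- arXiv:2603.27874 — 2 statements merged into one kernel-verified Lean document; each statement's English description precedes it below -/
import Mathlib

section
/- Let Ξ be a d×d real matrix for which 0 is a simple eigenvalue, all other eigenvalues of the complexification of Ξ have strictly negative real part, and let η ∈ ℝ^d be a unit vector with Ξη = 0 and ηᵀΞ = 0. Let v, w ∈ ℝ^d be nonzero vectors with (ηᵀv)(wᵀη) < 0. Then there exists t₀ > 0 such that for every t ∈ (0, t₀) the matrix Ξ + t·v wᵀ is Hurwitz. -/
open Matrix

/-- A real square matrix is Hurwitz if every eigenvalue of its complexification
(i.e. every complex root of the characteristic polynomial) has strictly negative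
real part. -/
def IsHurwitz {d : ℕ} (A : Matrix (Fin d) (Fin d) ℝ) : Prop :=
  ∀ μ : ℂ, Polynomial.IsRoot (A.map Complex.ofReal).charpoly μ → μ.re < 0

open Filter Topology

/-- Every root of the characteristic polynomial of a complex matrix has an eigenvector of norm
one. -/
lemma exists_norm_eq_one_mulVec_eq_smul {n : Type*} [Fintype n] [DecidableEq n]
    {A : Matrix n n ℂ} {μ : ℂ} (h : A.charpoly.IsRoot μ) :
    ∃ x : n → ℂ, ‖x‖ = 1 ∧ A *ᵥ x = μ • x := by
  rw [← charpoly_toLin', ← Module.End.hasEigenvalue_iff_isRoot_charpoly] at h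
  obtain ⟨x, hx⟩ := h.exists_hasEigenvector
  have hAx : A *ᵥ x = μ • x := by simpa using hx.apply_eq_smul
  refine ⟨(‖x‖⁻¹ : ℂ) • x, ?_, ?_⟩
  · exact norm_smul_inv_norm hx.2
  · rw [mulVec_smul, hAx, smul_comm]

/-- An eigenspace of a matrix for an eigenvalue of algebraic multiplicity at most one is spanned by
any of its nonzero vectors. -/
lemma exists_eq_smul_of_rootMultiplicity_charpoly_le_one {n K : Type*} [Fintype n] [DecidableEq n]
    [Field K] {A : Matrix n n K} {μ : K} (h : A.charpoly.rootMultiplicity μ ≤ 1) {x y : n → K}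
    (hy : y ≠ 0) (hAy : A *ᵥ y = μ • y) (hAx : A *ᵥ x = μ • x) : ∃ c : K, x = c • y := by
  have hfin : Module.finrank K (Module.End.eigenspace A.toLin' μ) ≤ 1 :=
    (LinearMap.finrank_eigenspace_le _ _).trans (by rwa [charpoly_toLin'])
  obtain ⟨z, hz⟩ := finrank_le_one_iff.mp hfin
  obtain ⟨a, ha⟩ := hz ⟨x, by simpa [Module.End.mem_eigenspace_iff] using hAx⟩
  obtain ⟨b, hb⟩ := hz ⟨y, by simpa [Module.End.mem_eigenspace_iff] using hAy⟩
  replace ha : a • (z : n → K) = x := congrArg Subtype.val ha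
  replace hb : b • (z : n → K) = y := congrArg Subtype.val hb
  have hb0 : b ≠ 0 := by
    rintro rfl
    exact hy (by simpa using hb.symm)
  exact ⟨a / b, by rw [← ha, ← hb, smul_smul, div_mul_cancel₀ _ hb0]⟩

/-- Unit eigenvectors of a sequence of perturbations `B + sₖ • v wᵀ` with `sₖ → 0` accumulate,
together with their eigenvalues, at an eigenpair of `B`. -/
lemma exists_tendsto_eigenpair {n : Type*} [Fintype n] (B : Matrix n n ℂ) (v w : n → ℂ)
    {s : ℕ → ℂ} (hs : Tendsto s atTop (𝓝 0)) {μ : ℕ → ℂ} {x : ℕ → n → ℂ}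
    (hx : ∀ k, ‖x k‖ = 1) (hxμ : ∀ k, B *ᵥ x k + (s k * (w ⬝ᵥ x k)) • v = μ k • x k) :
    ∃ (ν : ℂ) (y : n → ℂ) (φ : ℕ → ℕ), StrictMono φ ∧ ‖y‖ = 1 ∧ B *ᵥ y = ν • y ∧
      Tendsto (μ ∘ φ) atTop (𝓝 ν) ∧ Tendsto (x ∘ φ) atTop (𝓝 y) := by
  obtain ⟨y, hy, φ, hφ, hxy⟩ :=
    (isCompact_sphere (0 : n → ℂ) 1).tendsto_subseq (x := x) fun k => by simp [hx k]
  have hcont : Tendsto (fun k => B *ᵥ x (φ k) + (s (φ k) * (w ⬝ᵥ x (φ k))) • v) atTop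
      (𝓝 (B *ᵥ y + ((0 : ℂ) * (w ⬝ᵥ y)) • v)) := by
    have hB : Continuous fun z : n → ℂ => B *ᵥ z := by fun_prop
    have hw : Continuous fun z : n → ℂ => w ⬝ᵥ z := by fun_prop
    exact ((hB.tendsto y).comp hxy).add
      (((hs.comp hφ.tendsto_atTop).mul ((hw.tendsto y).comp hxy)).smul_const v)
  simp only [hxμ, zero_mul, zero_smul, add_zero] at hcont
  have hnorm := hcont.norm
  simp only [norm_smul, hx, mul_one] at hnorm
  have hbdd : Bornology.IsBounded (Set.range (μ ∘ φ)) := by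
    obtain ⟨C, hC⟩ := (Metric.isBounded_range_of_tendsto _ hnorm).exists_norm_le
    exact isBounded_iff_forall_norm_le.mpr ⟨C, by simpa using hC⟩
  obtain ⟨ν, -, ψ, hψ, hν⟩ := tendsto_subseq_of_bounded hbdd fun k => Set.mem_range_self k
  refine ⟨ν, y, φ ∘ ψ, hφ.comp hψ, by simpa using hy, ?_, hν, hxy.comp hψ.tendsto_atTop⟩
  exact tendsto_nhds_unique (hcont.comp hψ.tendsto_atTop)
    (hν.smul (hxy.comp hψ.tendsto_atTop))

/-- if `0` is a simple eigenvalue of `Ξ`, all other eigenvalues lie in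
the open left half plane, and `(ηᵀv)(wᵀη) < 0`, then `Ξ + t v wᵀ` is Hurwitz for
all sufficiently small `t > 0`. -/
theorem stmt_1 {d : ℕ} (hd : 1 ≤ d) (Ξ : Matrix (Fin d) (Fin d) ℝ)
    (η v w : Fin d → ℝ)
    (hsimple : Polynomial.rootMultiplicity (0 : ℝ) Ξ.charpoly = 1)
    (hother : ∀ μ : ℂ, Polynomial.IsRoot (Ξ.map Complex.ofReal).charpoly μ →
      μ ≠ 0 → μ.re < 0)
    (hnorm : Real.sqrt (∑ i, η i ^ 2) = 1)
    (hleft : Ξ.mulVec η = 0) (hright : Matrix.vecMul η Ξ = 0)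
    (hv : v ≠ 0) (hw : w ≠ 0)
    (hsign : (η ⬝ᵥ v) * (w ⬝ᵥ η) < 0) :
    ∃ t₀ > (0 : ℝ), ∀ t ∈ Set.Ioo (0 : ℝ) t₀,
      IsHurwitz (Ξ + t • Matrix.vecMulVec v w) := by
  by_contra! hcon
  have hseq (k : ℕ) : ∃ (t : ℝ) (μ : ℂ) (x : Fin d → ℂ), (0 < t ∧ t < 1 / ((k : ℝ) + 1)) ∧
      0 ≤ μ.re ∧ ‖x‖ = 1 ∧
      (Ξ.map Complex.ofReal) *ᵥ x + (t * ((Complex.ofReal ∘ w) ⬝ᵥ x)) • (Complex.ofReal ∘ v) =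
        μ • x := by
    obtain ⟨t, ht, hH⟩ := hcon (1 / ((k : ℝ) + 1)) (by positivity)
    simp only [IsHurwitz, not_forall, not_lt] at hH
    obtain ⟨μ, hroot, hμ⟩ := hH
    obtain ⟨x, hx, hxμ⟩ := exists_norm_eq_one_mulVec_eq_smul hroot
    refine ⟨t, μ, x, ht, hμ, hx, ?_⟩
    have hmap : (Ξ + t • vecMulVec v w).map Complex.ofReal = Ξ.map Complex.ofReal +
        (t : ℂ) • vecMulVec (Complex.ofReal ∘ v) (Complex.ofReal ∘ w) := by
      ext i j
      simp [vecMulVec_apply]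
    rw [← hxμ, hmap, add_mulVec, smul_mulVec, vecMulVec_mulVec, op_smul_eq_smul, smul_smul]
  choose t μ x ht hμ hx hxμ using hseq
  have ht0 : Tendsto (fun k => (t k : ℂ)) atTop (𝓝 0) := by
    have h : Tendsto t atTop (𝓝 0) := squeeze_zero (fun k => (ht k).1.le) (fun k => (ht k).2.le)
      tendsto_one_div_add_atTop_nhds_zero_nat
    exact_mod_cast (Complex.continuous_ofReal.tendsto 0).comp h
  obtain ⟨ν, y, φ, hφ, hy, hΞy, hμν, hxy⟩ :=
    exists_tendsto_eigenpair (Ξ.map Complex.ofReal) (Complex.ofReal ∘ v) (Complex.ofReal ∘ w)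
      ht0 hx hxμ
  have hy0 : y ≠ 0 := by
    rintro rfl
    simp at hy
  have hν0 : ν = 0 := by
    by_contra hne
    have hroot : (Ξ.map Complex.ofReal).charpoly.IsRoot ν := by
      rw [← charpoly_toLin', ← Module.End.hasEigenvalue_iff_isRoot_charpoly]
      exact Module.End.hasEigenvalue_of_hasEigenvector (x := y)
        ⟨by simpa [Module.End.mem_eigenspace_iff] using hΞy, hy0⟩
    have hre : 0 ≤ ν.re := ge_of_tendsto' ((Complex.continuous_re.tendsto ν).comp hμν)
      fun k => hμ (φ k)
    exact (hother ν hroot hne).not_ge hre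
  subst hν0
  have hηη : η ⬝ᵥ η = 1 := by
    simpa [dotProduct, sq] using Real.sqrt_eq_one.mp hnorm
  have hdot (a b : Fin d → ℝ) :
      (Complex.ofReal ∘ a) ⬝ᵥ (Complex.ofReal ∘ b) = ((a ⬝ᵥ b : ℝ) : ℂ) := by
    simp [dotProduct]
  have hη0 : Complex.ofReal ∘ η ≠ 0 := by
    intro h
    have := hdot η η
    simp [h, hηη] at this
  have hΞη : (Ξ.map Complex.ofReal) *ᵥ (Complex.ofReal ∘ η) = 0 := by
    ext i
    simpa [mulVec, dotProduct] using congrArg Complex.ofReal (congrFun hleft i)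
  have hηΞ : (Complex.ofReal ∘ η) ᵥ* (Ξ.map Complex.ofReal) = 0 := by
    ext i
    simpa [vecMul, dotProduct] using congrArg Complex.ofReal (congrFun hright i)
  have hmult : (Ξ.map Complex.ofReal).charpoly.rootMultiplicity 0 ≤ 1 := by
    have h := Polynomial.eq_rootMultiplicity_map (p := Ξ.charpoly) (f := Complex.ofRealHom)
      Complex.ofReal_injective 0
    rw [hsimple, ← charpoly_map, map_zero] at h
    exact h.ge
  obtain ⟨c, rfl⟩ := exists_eq_smul_of_rootMultiplicity_charpoly_le_one hmult hη0
    (by simpa using hΞη) hΞy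
  have hc : c ≠ 0 := by
    rintro rfl
    simp at hy0
  -- Pairing the eigenvalue equation with `η` removes `Ξ`.
  have hpair (k : ℕ) : 0 ≤ (((η ⬝ᵥ v : ℝ) : ℂ) * ((Complex.ofReal ∘ w) ⬝ᵥ x k) *
      star ((Complex.ofReal ∘ η) ⬝ᵥ x k)).re := by
    have h := congrArg ((Complex.ofReal ∘ η) ⬝ᵥ ·) (hxμ k)
    simp only [dotProduct_add, dotProduct_mulVec, hηΞ, zero_dotProduct, zero_add,
      dotProduct_smul, smul_eq_mul, hdot] at h
    set e := (Complex.ofReal ∘ η) ⬝ᵥ x k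
    set b := (Complex.ofReal ∘ w) ⬝ᵥ x k
    have h2 : (t k : ℂ) * (((η ⬝ᵥ v : ℝ) : ℂ) * b * star e) = μ k * (Complex.normSq e : ℂ) := by
      rw [← Complex.mul_conj, ← mul_assoc (μ k), ← h, starRingEnd_apply]
      ring
    have h3 := congrArg Complex.re h2
    rw [Complex.re_ofReal_mul, Complex.re_mul_ofReal] at h3
    exact nonneg_of_mul_nonneg_right
      (h3 ▸ mul_nonneg (hμ k) (Complex.normSq_nonneg e)) (ht k).1
  have hcont : Continuous fun z : Fin d → ℂ => (((η ⬝ᵥ v : ℝ) : ℂ) * ((Complex.ofReal ∘ w) ⬝ᵥ z) *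
      star ((Complex.ofReal ∘ η) ⬝ᵥ z)).re := by fun_prop
  have hlim := ge_of_tendsto' ((hcont.tendsto _).comp hxy) fun k => hpair (φ k)
  have hval : ((η ⬝ᵥ v : ℝ) : ℂ) * ((w ⬝ᵥ η : ℝ) * c) * star c =
      (((η ⬝ᵥ v) * (w ⬝ᵥ η) * Complex.normSq c : ℝ) : ℂ) := by
    push_cast
    rw [← Complex.mul_conj, starRingEnd_apply]
    ring
  rw [dotProduct_smul, dotProduct_smul, hdot, hdot, hηη, smul_eq_mul, smul_eq_mul,
    Complex.ofReal_one, mul_one, mul_comm c, hval, Complex.ofReal_re] at hlim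
  exact (mul_neg_of_neg_of_pos hsign (Complex.normSq_pos.mpr hc)).not_ge hlim
end

section
/- Suppose P is primitive, i.e. there exists m ≥ 1 such that (P^m)(z,z') > 0 for all z, z', that π(z) > 0 for all z, and that Σ(0) is positive definite. Fix λ ∈ [0,1) and let μ : Z → ℝ be any probability vector, with ψ̄^μ = ∑_z μ(z) ψ(z). Then there exists δ⁰ > 0 such that for every γ ∈ [0,1] and every δ ∈ [0, δ⁰), the matrix Ā(λ,γ) − (δ/(1−λγ))·ψ̄ (ψ̄^μ)ᵀ is Hurwitz. -/
open Matrix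

/-- The autocorrelation matrix `R(k) = ∑_{z,z'} π(z) (P^k)(z,z') ψ(z) ψ(z')ᵀ`. -/
noncomputable def Rmat {Z : Type*} [Fintype Z] [DecidableEq Z] {d : ℕ}
    (P : Matrix Z Z ℝ) (π : Z → ℝ) (ψ : Z → Fin d → ℝ) (k : ℕ) :
    Matrix (Fin d) (Fin d) ℝ :=
  ∑ z, ∑ z', (π z * (P ^ k) z z') • Matrix.vecMulVec (ψ z) (ψ z')

/-- The mean feature vector `ψ̄ = ∑_z π(z) ψ(z)`. -/
noncomputable def psibar {Z : Type*} [Fintype Z] {d : ℕ} (π : Z → ℝ)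
    (ψ : Z → Fin d → ℝ) : Fin d → ℝ :=
  ∑ z, π z • ψ z

/-- The autocovariance matrix `Σ(0) = R(0) − ψ̄ ψ̄ᵀ`. -/
noncomputable def Sigma0 {Z : Type*} [Fintype Z] [DecidableEq Z] {d : ℕ}
    (P : Matrix Z Z ℝ) (π : Z → ℝ) (ψ : Z → Fin d → ℝ) :
    Matrix (Fin d) (Fin d) ℝ :=
  Rmat P π ψ 0 - Matrix.vecMulVec (psibar π ψ) (psibar π ψ)

/-- The TD(λ) mean-flow matrix
`Ā(λ,γ) = −∑_{k≥0} (λγ)^k R(k) + γ ∑_{k≥0} (λγ)^k R(k+1)`. -/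
noncomputable def Abar {Z : Type*} [Fintype Z] [DecidableEq Z] {d : ℕ}
    (P : Matrix Z Z ℝ) (π : Z → ℝ) (ψ : Z → Fin d → ℝ) (lam gam : ℝ) :
    Matrix (Fin d) (Fin d) ℝ :=
  -(∑' k : ℕ, (lam * gam) ^ k • Rmat P π ψ k)
    + gam • ∑' k : ℕ, (lam * gam) ^ k • Rmat P π ψ (k + 1)

/-- For a row-stochastic kernel `Q` with invariant vector `π` and a sign `s`,
`∑ π(z) Q(z,z') (f z - s f z')² = 2 (⟨f, f⟩ - s ⟨f, Q f⟩)` in `L²(π)`. -/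
lemma dirichlet_form_eq {Z : Type*} [Fintype Z] {Q : Matrix Z Z ℝ} {π : Z → ℝ}
    (hQ1 : ∀ z, ∑ z', Q z z' = 1) (hinv : ∀ z', ∑ z, π z * Q z z' = π z') (f : Z → ℝ) (s : ℝ)
    (hs : s ^ 2 = 1) :
    ∑ z, ∑ z', π z * Q z z' * (f z - s * f z') ^ 2
      = 2 * (∑ z, π z * f z ^ 2 - s * ∑ z, ∑ z', π z * Q z z' * (f z * f z')) := by
  have h1 : ∑ z, ∑ z', π z * Q z z' * f z ^ 2 = ∑ z, π z * f z ^ 2 := by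
    refine Finset.sum_congr rfl fun z _ => ?_
    rw [← Finset.sum_mul, ← Finset.mul_sum, hQ1, mul_one]
  have h2 : ∑ z, ∑ z', π z * Q z z' * f z' ^ 2 = ∑ z, π z * f z ^ 2 := by
    rw [Finset.sum_comm]
    refine Finset.sum_congr rfl fun z _ => ?_
    rw [← Finset.sum_mul, hinv]
  have h3 : ∀ z z', π z * Q z z' * (f z - s * f z') ^ 2
      = π z * Q z z' * f z ^ 2 + π z * Q z z' * f z' ^ 2
        - 2 * s * (π z * Q z z' * (f z * f z')) := by
    intro z z'
    linear_combination π z * Q z z' * f z' ^ 2 * hs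
  simp only [h3, Finset.sum_sub_distrib, Finset.sum_add_distrib, h1, h2, ← Finset.mul_sum]
  ring

lemma abs_correlation_le {Z : Type*} [Fintype Z] {Q : Matrix Z Z ℝ} {π : Z → ℝ}
    (hQ0 : ∀ z z', 0 ≤ Q z z') (hQ1 : ∀ z, ∑ z', Q z z' = 1) (hπ : ∀ z, 0 ≤ π z)
    (hinv : ∀ z', ∑ z, π z * Q z z' = π z') (f : Z → ℝ) :
    |∑ z, ∑ z', π z * Q z z' * (f z * f z')| ≤ ∑ z, π z * f z ^ 2 := by
  have key : ∀ s : ℝ, 0 ≤ ∑ z, ∑ z', π z * Q z z' * (f z - s * f z') ^ 2 := fun s =>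
    Finset.sum_nonneg fun z _ => Finset.sum_nonneg fun z' _ =>
      mul_nonneg (mul_nonneg (hπ z) (hQ0 z z')) (sq_nonneg _)
  have h1 := key 1
  have h2 := key (-1)
  rw [dirichlet_form_eq hQ1 hinv f _ (by norm_num)] at h1 h2
  rw [abs_le]
  constructor <;> linarith

lemma pow_stochastic {Z : Type*} [Fintype Z] [DecidableEq Z] {P : Matrix Z Z ℝ} {π : Z → ℝ}
    (hP0 : ∀ z z', 0 ≤ P z z') (hP1 : ∀ z, ∑ z', P z z' = 1)
    (hinv : ∀ z', ∑ z, π z * P z z' = π z') (k : ℕ) :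
    (∀ z z', 0 ≤ (P ^ k) z z') ∧ (∀ z, ∑ z', (P ^ k) z z' = 1) ∧
      ∀ z', ∑ z, π z * (P ^ k) z z' = π z' := by
  induction k with
  | zero =>
    refine ⟨fun z z' => ?_, fun z => ?_, fun z' => ?_⟩
    · rw [pow_zero, Matrix.one_apply]; split_ifs <;> norm_num
    · simp [Matrix.one_apply]
    · simp [Matrix.one_apply]
  | succ k ih =>
    obtain ⟨h0, h1, h2⟩ := ih
    refine ⟨fun z z' => ?_, fun z => ?_, fun z' => ?_⟩
    · rw [pow_succ, Matrix.mul_apply]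
      exact Finset.sum_nonneg fun w _ => mul_nonneg (h0 z w) (hP0 w z')
    · simp only [pow_succ, Matrix.mul_apply]
      rw [Finset.sum_comm]
      simp only [← Finset.mul_sum, hP1, mul_one, h1]
    · simp only [pow_succ, Matrix.mul_apply, Finset.mul_sum]
      rw [Finset.sum_comm]
      simp only [← mul_assoc, ← Finset.sum_mul, h2, hinv]

lemma eq_of_pow_pos {Z X : Type*} [Fintype Z] [DecidableEq Z] {P : Matrix Z Z ℝ}
    (hP0 : ∀ z z', 0 ≤ P z z') {f : Z → X} (hf : ∀ z z', 0 < P z z' → f z = f z') (k : ℕ) :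
    ∀ z z', 0 < (P ^ k) z z' → f z = f z' := by
  induction k with
  | zero =>
    intro z z' h
    by_contra hne
    have : z ≠ z' := fun e => hne (congrArg f e)
    simp [this] at h
  | succ k ih =>
    intro z z' h
    rw [pow_succ, Matrix.mul_apply] at h
    obtain ⟨w, -, hw⟩ := Finset.exists_lt_of_sum_lt (s := Finset.univ) (f := fun _ : Z => (0 : ℝ))
      (by simpa using h)
    have hwz : 0 < P w z' := (hP0 w z').lt_of_ne fun e => by simp [← e] at hw
    exact (ih z w (pos_of_mul_pos_left hw (hP0 w z'))).trans (hf w z' hwz)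

lemma dotProduct_vecMulVec_mulVec {n : Type*} [Fintype n] (u v θ : n → ℝ) :
    θ ⬝ᵥ (vecMulVec u v) *ᵥ θ = (u ⬝ᵥ θ) * (v ⬝ᵥ θ) := by
  rw [vecMulVec_mulVec]
  simp [dotProduct_comm θ u, mul_comm]

lemma Rmat_form {Z : Type*} [Fintype Z] [DecidableEq Z] {d : ℕ}
    (P : Matrix Z Z ℝ) (π : Z → ℝ) (ψ : Z → Fin d → ℝ) (k : ℕ) (θ : Fin d → ℝ) :
    θ ⬝ᵥ (Rmat P π ψ k) *ᵥ θ
      = ∑ z, ∑ z', π z * (P ^ k) z z' * ((ψ z ⬝ᵥ θ) * (ψ z' ⬝ᵥ θ)) := by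
  simp only [Rmat, Matrix.sum_mulVec, dotProduct_sum, Matrix.smul_mulVec, dotProduct_smul,
    dotProduct_vecMulVec_mulVec, smul_eq_mul]

lemma Rmat_zero_form {Z : Type*} [Fintype Z] [DecidableEq Z] {d : ℕ}
    (P : Matrix Z Z ℝ) (π : Z → ℝ) (ψ : Z → Fin d → ℝ) (θ : Fin d → ℝ) :
    θ ⬝ᵥ (Rmat P π ψ 0) *ᵥ θ = ∑ z, π z * (ψ z ⬝ᵥ θ) ^ 2 := by
  simp [Rmat_form, Matrix.one_apply, sq]

/-- A matrix with positive quadratic form dominates the quadratic form of any other matrix. -/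
lemma exists_mul_abs_form_le {d : ℕ} (M N : Matrix (Fin d) (Fin d) ℝ)
    (hM : ∀ θ : Fin d → ℝ, θ ≠ 0 → 0 < θ ⬝ᵥ M *ᵥ θ) :
    ∃ ε > (0 : ℝ), ∀ θ : Fin d → ℝ, ε * |θ ⬝ᵥ N *ᵥ θ| ≤ θ ⬝ᵥ M *ᵥ θ := by
  have hcont : ∀ A : Matrix (Fin d) (Fin d) ℝ, Continuous fun θ : Fin d → ℝ => θ ⬝ᵥ A *ᵥ θ :=
    fun A => continuous_id.dotProduct (continuous_const.matrix_mulVec continuous_id)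
  have hscale : ∀ (A : Matrix (Fin d) (Fin d) ℝ) (t : ℝ) (θ : Fin d → ℝ),
      (t • θ) ⬝ᵥ A *ᵥ (t • θ) = t ^ 2 * (θ ⬝ᵥ A *ᵥ θ) := by
    intro A t θ
    simp only [Matrix.mulVec_smul, dotProduct_smul, smul_dotProduct, smul_eq_mul]
    ring
  have hne : ∀ x ∈ Metric.sphere (0 : Fin d → ℝ) 1, x ≠ 0 := fun x hx =>
    Metric.ne_of_mem_sphere hx one_ne_zero
  obtain ⟨C, hC⟩ := (isCompact_sphere (0 : Fin d → ℝ) 1).exists_bound_of_continuousOn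
    (f := fun θ : Fin d → ℝ => (θ ⬝ᵥ N *ᵥ θ) / (θ ⬝ᵥ M *ᵥ θ))
    ((hcont N).continuousOn.div (hcont M).continuousOn fun x hx => (hM x (hne x hx)).ne')
  refine ⟨1 / (|C| + 1), by positivity, fun θ => ?_⟩
  rcases eq_or_ne θ 0 with rfl | hθ
  · simp
  have hn : 0 < ‖θ‖ := norm_pos_iff.mpr hθ
  have hmem : ‖θ‖⁻¹ • θ ∈ Metric.sphere (0 : Fin d → ℝ) 1 := by
    simp [norm_smul, hn.ne']
  have h := hC _ hmem
  simp only [hscale] at h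
  rw [mul_div_mul_left _ _ (by positivity), Real.norm_eq_abs, abs_div, abs_of_pos (hM θ hθ),
    div_le_iff₀ (hM θ hθ)] at h
  have h0 := hM θ hθ
  rw [one_div, inv_mul_le_iff₀ (by positivity)]
  nlinarith [le_abs_self C]

/-- A real matrix whose quadratic form is negative definite is Hurwitz. -/
lemma isHurwitz_of_form_neg {d : ℕ} (A : Matrix (Fin d) (Fin d) ℝ)
    (hA : ∀ θ : Fin d → ℝ, θ ≠ 0 → θ ⬝ᵥ A *ᵥ θ < 0) : IsHurwitz A := by
  intro c hc
  obtain ⟨v, hv⟩ : ∃ v, Module.End.HasEigenvector (Matrix.toLin' (A.map Complex.ofReal)) c v := by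
    refine Module.End.HasEigenvalue.exists_hasEigenvector ?_
    rw [Module.End.hasEigenvalue_iff_isRoot_charpoly, Matrix.charpoly_toLin']
    exact hc
  have hAv : (A.map Complex.ofReal) *ᵥ v = c • v := by
    simpa [Matrix.toLin'_apply] using hv.apply_eq_smul
  set x : Fin d → ℝ := fun i => (v i).re with hx
  set y : Fin d → ℝ := fun i => (v i).im with hy
  have hre : A *ᵥ x = c.re • x - c.im • y := by
    ext i
    simpa [Matrix.mulVec, dotProduct] using congrArg Complex.re (congrFun hAv i)
  have him : A *ᵥ y = c.re • y + c.im • x := by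
    ext i
    simpa [Matrix.mulVec, dotProduct] using congrArg Complex.im (congrFun hAv i)
  have hsum : x ⬝ᵥ A *ᵥ x + y ⬝ᵥ A *ᵥ y = c.re * (x ⬝ᵥ x + y ⬝ᵥ y) := by
    rw [hre, him]
    simp only [dotProduct_sub, dotProduct_add, dotProduct_smul, smul_eq_mul, dotProduct_comm y x]
    ring
  have hxy : x ≠ 0 ∨ y ≠ 0 := by
    by_contra! h
    exact hv.2 (funext fun i => Complex.ext (congrFun h.1 i) (congrFun h.2 i))
  have hle : ∀ θ : Fin d → ℝ, θ ⬝ᵥ A *ᵥ θ ≤ 0 := fun θ => by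
    rcases eq_or_ne θ 0 with rfl | hθ
    · simp
    · exact (hA θ hθ).le
  have hneg : c.re * (x ⬝ᵥ x + y ⬝ᵥ y) < 0 := by
    rw [← hsum]
    rcases hxy with h | h
    · linarith [hA x h, hle y]
    · linarith [hA y h, hle x]
  have hsq : ∀ θ : Fin d → ℝ, 0 ≤ θ ⬝ᵥ θ := fun θ =>
    Finset.sum_nonneg fun i _ => mul_self_nonneg (θ i)
  exact neg_of_mul_neg_left hneg (add_nonneg (hsq x) (hsq y))

lemma hasSum_form {d : ℕ} {F : ℕ → Matrix (Fin d) (Fin d) ℝ} (hF : Summable F)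
    (θ : Fin d → ℝ) :
    HasSum (fun k => θ ⬝ᵥ F k *ᵥ θ) (θ ⬝ᵥ (∑' k, F k) *ᵥ θ) := by
  let L : Matrix (Fin d) (Fin d) ℝ →+ ℝ :=
    { toFun := fun A => θ ⬝ᵥ A *ᵥ θ
      map_zero' := by simp
      map_add' := fun A B => by simp [Matrix.add_mulVec] }
  exact hF.hasSum.map L
    (continuous_const.dotProduct (continuous_id.matrix_mulVec continuous_const))

lemma summable_smul_Rmat {Z : Type*} [Fintype Z] [DecidableEq Z] {d : ℕ}
    {P : Matrix Z Z ℝ} {π : Z → ℝ}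
    (hP0 : ∀ z z', 0 ≤ P z z') (hP1 : ∀ z, ∑ z', P z z' = 1)
    (hinv : ∀ z', ∑ z, π z * P z z' = π z') (ψ : Z → Fin d → ℝ) {c : ℝ} (hc0 : 0 ≤ c)
    (hc1 : c < 1) (j : ℕ) : Summable fun k => c ^ k • Rmat P π ψ (k + j) := by
  simp only [Rmat, Finset.smul_sum, smul_smul]
  refine summable_sum fun z _ => summable_sum fun z' _ => Summable.smul_const ?_ _
  refine Summable.of_norm_bounded (g := fun k => c ^ k * |π z|)
    ((summable_geometric_of_lt_one hc0 hc1).mul_right _) fun k => ?_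
  obtain ⟨h0, h1, -⟩ := pow_stochastic hP0 hP1 hinv (k + j)
  have hle : (P ^ (k + j)) z z' ≤ 1 := by
    rw [← h1 z]
    exact Finset.single_le_sum (f := fun w => (P ^ (k + j)) z w) (fun w _ => h0 z w)
      (Finset.mem_univ z')
  rw [norm_mul, norm_mul, Real.norm_eq_abs, Real.norm_eq_abs, Real.norm_eq_abs,
    abs_of_nonneg (pow_nonneg hc0 k), abs_of_nonneg (h0 z z')]
  exact mul_le_mul_of_nonneg_left (mul_le_of_le_one_right (abs_nonneg _) hle) (pow_nonneg hc0 k)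

/-- Bound on the scalar series arising from the quadratic form of the mean-flow matrix. -/
lemma td_series_le {a : ℕ → ℝ} (ha : ∀ k, |a k| ≤ a 0) {lam gam S T : ℝ} (hl0 : 0 ≤ lam)
    (hl1 : lam < 1) (hg0 : 0 ≤ gam) (hg1 : gam ≤ 1)
    (hS : HasSum (fun k => (lam * gam) ^ k * a k) S)
    (hT : HasSum (fun k => (lam * gam) ^ k * a (k + 1)) T) :
    -S + gam * T ≤ -((1 - lam) / 2 * (a 0 - a 1)) := by
  set c := lam * gam with hc
  have hc0 : 0 ≤ c := mul_nonneg hl0 hg0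
  have hcl : c ≤ lam := mul_le_of_le_one_right hl0 hg1
  have hc1 : c < 1 := hcl.trans_lt hl1
  have hST : S = a 0 + c * T := by
    refine hS.unique ?_
    refine (hasSum_nat_add_iff' 1).mp ?_
    have h := hT.mul_left c
    simp only [← mul_assoc, ← pow_succ'] at h
    simpa using h
  have hTle : T ≤ a 1 + c * (a 0 * (1 - c)⁻¹) := by
    have h1 := (hasSum_nat_add_iff' 1).mpr hT
    have h2 := ((hasSum_geometric_of_lt_one hc0 hc1).mul_left (c * a 0))
    have h3 := hasSum_le (fun k => ?_) h1 h2
    · simp at h3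
      linarith
    · have := mul_le_mul_of_nonneg_left ((le_abs_self _).trans (ha (k + 1 + 1)))
        (pow_nonneg hc0 (k + 1))
      calc _ ≤ c ^ (k + 1) * a 0 := this
        _ = _ := by ring
  have h1c : 0 < 1 - c := by linarith
  have ha0 : 0 ≤ a 0 := (abs_nonneg _).trans (ha 0)
  have hD : a 0 - a 1 ≤ 2 * a 0 := by linarith [neg_abs_le (a 1), ha 1]
  have hD0 : 0 ≤ a 0 - a 1 := by linarith [le_abs_self (a 1), ha 1]
  have hg : 0 ≤ gam * (1 - lam) := mul_nonneg hg0 (by linarith)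
  have hstep : -S + gam * T ≤ -a 0 + gam * (1 - lam) * (a 1 + c * (a 0 * (1 - c)⁻¹)) := by
    calc -S + gam * T = -a 0 + gam * (1 - lam) * T := by rw [hST, hc]; ring
      _ ≤ _ := by linarith [mul_le_mul_of_nonneg_left hTle hg]
  have hid : -a 0 + gam * (1 - lam) * (a 1 + c * (a 0 * (1 - c)⁻¹))
      = -((1 - gam) * (1 - c)⁻¹ * a 0) - gam * (1 - lam) * (a 0 - a 1) := by
    have : gam * (1 - lam) = (1 - c) - (1 - gam) := by rw [hc]; ring
    rw [this]
    field_simp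
    ring
  have hinv : 1 ≤ (1 - c)⁻¹ := (one_le_inv₀ h1c).mpr (by linarith)
  have h5 : (1 - gam) * a 0 ≤ (1 - gam) * (1 - c)⁻¹ * a 0 := by
    have := mul_le_mul_of_nonneg_left hinv (mul_nonneg (sub_nonneg.mpr hg1) ha0)
    linarith
  have h6 : (1 - gam) * (a 0 - a 1) ≤ (1 - gam) * (2 * a 0) :=
    mul_le_mul_of_nonneg_left hD (by linarith)
  have h7 : 0 ≤ lam * (1 - gam) * (a 0 - a 1) :=
    mul_nonneg (mul_nonneg hl0 (by linarith)) hD0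
  have h8 : 0 ≤ gam * (1 - lam) * (a 0 - a 1) := mul_nonneg hg hD0
  rw [hid] at hstep
  nlinarith

lemma Abar_form_le {Z : Type*} [Fintype Z] [DecidableEq Z] {d : ℕ}
    {P : Matrix Z Z ℝ} {π : Z → ℝ}
    (hP0 : ∀ z z', 0 ≤ P z z') (hP1 : ∀ z, ∑ z', P z z' = 1) (hπ : ∀ z, 0 ≤ π z)
    (hinv : ∀ z', ∑ z, π z * P z z' = π z') (ψ : Z → Fin d → ℝ) {lam gam : ℝ}
    (hl0 : 0 ≤ lam) (hl1 : lam < 1) (hg0 : 0 ≤ gam) (hg1 : gam ≤ 1) (θ : Fin d → ℝ) :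
    θ ⬝ᵥ (Abar P π ψ lam gam) *ᵥ θ
      ≤ -((1 - lam) / 2 * (θ ⬝ᵥ (Rmat P π ψ 0 - Rmat P π ψ 1) *ᵥ θ)) := by
  have hc0 : 0 ≤ lam * gam := mul_nonneg hl0 hg0
  have hc1 : lam * gam < 1 := (mul_le_of_le_one_right hl0 hg1).trans_lt hl1
  have hS := hasSum_form (summable_smul_Rmat hP0 hP1 hinv ψ hc0 hc1 0) θ
  have hT := hasSum_form (summable_smul_Rmat hP0 hP1 hinv ψ hc0 hc1 1) θ
  simp only [Matrix.smul_mulVec, dotProduct_smul, smul_eq_mul, add_zero] at hS hT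
  have ha : ∀ k, |θ ⬝ᵥ (Rmat P π ψ k) *ᵥ θ| ≤ θ ⬝ᵥ (Rmat P π ψ 0) *ᵥ θ := fun k => by
    obtain ⟨h0, h1, h2⟩ := pow_stochastic hP0 hP1 hinv k
    rw [Rmat_zero_form, Rmat_form]
    exact abs_correlation_le h0 h1 hπ h2 _
  have h := td_series_le (a := fun k => θ ⬝ᵥ (Rmat P π ψ k) *ᵥ θ) ha hl0 hl1 hg0 hg1 hS hT
  simpa only [Abar, Matrix.add_mulVec, Matrix.neg_mulVec, Matrix.smul_mulVec, Matrix.sub_mulVec,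
    dotProduct_add, dotProduct_neg, dotProduct_smul, dotProduct_sub, smul_eq_mul] using h

/-- Under irreducibility and `Σ(0) > 0`, the Dirichlet form is positive definite. -/
lemma Rmat_sub_form_pos {Z : Type*} [Fintype Z] [Nonempty Z] [DecidableEq Z] {d : ℕ}
    {P : Matrix Z Z ℝ} {π : Z → ℝ}
    (hP0 : ∀ z z', 0 ≤ P z z') (hP1 : ∀ z, ∑ z', P z z' = 1)
    (hprim : ∃ m : ℕ, 1 ≤ m ∧ ∀ z z', 0 < (P ^ m) z z')
    (hπpos : ∀ z, 0 < π z) (hπ1 : ∑ z, π z = 1)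
    (hinv : ∀ z', ∑ z, π z * P z z' = π z') {ψ : Z → Fin d → ℝ} {θ : Fin d → ℝ}
    (hSig : 0 < θ ⬝ᵥ (Sigma0 P π ψ) *ᵥ θ) :
    0 < θ ⬝ᵥ (Rmat P π ψ 0 - Rmat P π ψ 1) *ᵥ θ := by
  set f : Z → ℝ := fun z => ψ z ⬝ᵥ θ with hf
  have hform : ∑ z, ∑ z', π z * P z z' * (f z - f z') ^ 2
      = 2 * (θ ⬝ᵥ (Rmat P π ψ 0 - Rmat P π ψ 1) *ᵥ θ) := by
    have h := dirichlet_form_eq hP1 hinv f 1 (by norm_num)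
    rw [Matrix.sub_mulVec, dotProduct_sub, Rmat_zero_form, Rmat_form]
    simpa using h
  have hterm : ∀ z z', 0 ≤ π z * P z z' * (f z - f z') ^ 2 := fun z z' =>
    mul_nonneg (mul_nonneg (hπpos z).le (hP0 z z')) (sq_nonneg _)
  by_contra hcon
  have hzero : ∑ z, ∑ z', π z * P z z' * (f z - f z') ^ 2 = 0 :=
    le_antisymm (by rw [hform]; linarith)
      (Finset.sum_nonneg fun z _ => Finset.sum_nonneg fun z' _ => hterm z z')
  have hedge : ∀ z z', 0 < P z z' → f z = f z' := by
    intro z z' hpos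
    have h1 := (Finset.sum_eq_zero_iff_of_nonneg fun z _ =>
      Finset.sum_nonneg fun z' _ => hterm z z').mp hzero z (Finset.mem_univ z)
    have h2 := (Finset.sum_eq_zero_iff_of_nonneg fun z' _ => hterm z z').mp h1 z'
      (Finset.mem_univ z')
    have h3 := (mul_eq_zero.mp h2).resolve_left (mul_pos (hπpos z) hpos).ne'
    exact sub_eq_zero.mp (pow_eq_zero_iff two_ne_zero |>.mp h3)
  obtain ⟨m, -, hm⟩ := hprim
  obtain ⟨z₀⟩ := ‹Nonempty Z›
  have hconst : ∀ z, ψ z ⬝ᵥ θ = f z₀ := fun z => eq_of_pow_pos hP0 hedge m z z₀ (hm z z₀)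
  have hmean : psibar π ψ ⬝ᵥ θ = f z₀ := by
    simp only [psibar, sum_dotProduct, smul_dotProduct, smul_eq_mul, hconst]
    rw [← Finset.sum_mul, hπ1, one_mul]
  rw [Sigma0, Matrix.sub_mulVec, dotProduct_sub, Rmat_zero_form, dotProduct_vecMulVec_mulVec,
    hmean] at hSig
  simp only [hconst] at hSig
  rw [← Finset.sum_mul, hπ1] at hSig
  linarith

/-- if `P` is primitive, `π > 0` and `Σ(0) > 0`, then for fixed
`λ ∈ [0,1)` and any probability vector `μ` there is `δ⁰ > 0` such that
`Ā(λ,γ) − (δ/(1−λγ)) ψ̄ (ψ̄^μ)ᵀ` is Hurwitz for every `γ ∈ [0,1]` and every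
`δ ∈ [0, δ⁰)`. -/
theorem stmt_14 {Z : Type*} [Fintype Z] [Nonempty Z] [DecidableEq Z]
    (P : Matrix Z Z ℝ)
    (hP0 : ∀ z z', 0 ≤ P z z') (hP1 : ∀ z, ∑ z', P z z' = 1)
    (hprim : ∃ m : ℕ, 1 ≤ m ∧ ∀ z z', 0 < (P ^ m) z z')
    (π : Z → ℝ) (hπpos : ∀ z, 0 < π z) (hπ1 : ∑ z, π z = 1)
    (hinv : ∀ z', ∑ z, π z * P z z' = π z')
    {d : ℕ} (hd : 1 ≤ d) (ψ : Z → Fin d → ℝ)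
    (hSig : ∀ θ : Fin d → ℝ, θ ≠ 0 → 0 < θ ⬝ᵥ (Sigma0 P π ψ).mulVec θ)
    (lam : ℝ) (hlam : lam ∈ Set.Ico (0 : ℝ) 1)
    (μ : Z → ℝ) (hμ0 : ∀ z, 0 ≤ μ z) (hμ1 : ∑ z, μ z = 1) :
    ∃ δ0 > (0 : ℝ), ∀ gam ∈ Set.Icc (0 : ℝ) 1, ∀ δ ∈ Set.Ico (0 : ℝ) δ0,
      IsHurwitz (Abar P π ψ lam gam
        - (δ / (1 - lam * gam)) •
          Matrix.vecMulVec (psibar π ψ) (psibar μ ψ)) := by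
  obtain ⟨hl0, hl1⟩ := hlam
  have hM : ∀ θ : Fin d → ℝ, θ ≠ 0 → 0 < θ ⬝ᵥ (Rmat P π ψ 0 - Rmat P π ψ 1) *ᵥ θ := fun θ hθ =>
    Rmat_sub_form_pos hP0 hP1 hprim hπpos hπ1 hinv (hSig θ hθ)
  obtain ⟨ε, hε, hdom⟩ := exists_mul_abs_form_le _ (vecMulVec (psibar π ψ) (psibar μ ψ)) hM
  have h1l : 0 < 1 - lam := sub_pos.mpr hl1
  refine ⟨ε * ((1 - lam) / 2) * (1 - lam), by positivity, ?_⟩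
  rintro gam ⟨hg0, hg1⟩ δ ⟨hδ0, hδ1⟩
  refine isHurwitz_of_form_neg _ fun θ hθ => ?_
  have hA := Abar_form_le hP0 hP1 (fun z => (hπpos z).le) hinv ψ hl0 hl1 hg0 hg1 θ
  rw [Matrix.sub_mulVec, dotProduct_sub, Matrix.smul_mulVec, dotProduct_smul, smul_eq_mul]
  set D := θ ⬝ᵥ (Rmat P π ψ 0 - Rmat P π ψ 1) *ᵥ θ with hD
  set B := θ ⬝ᵥ vecMulVec (psibar π ψ) (psibar μ ψ) *ᵥ θ with hB
  have hcl : 1 - lam ≤ 1 - lam * gam := by linarith [mul_le_of_le_one_right hl0 hg1]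
  have ht0 : 0 ≤ δ / (1 - lam * gam) := div_nonneg hδ0 (h1l.le.trans hcl)
  have ht : δ / (1 - lam * gam) < ε * ((1 - lam) / 2) := by
    rw [div_lt_iff₀ (h1l.trans_le hcl)]
    exact hδ1.trans_le (mul_le_mul_of_nonneg_left hcl (by positivity))
  have hDpos : 0 < D := hM θ hθ
  have hBt : -(δ / (1 - lam * gam) * B) ≤ δ / (1 - lam * gam) * |B| := by
    rw [← mul_neg]
    exact mul_le_mul_of_nonneg_left (neg_le_abs B) ht0
  have hlt : δ / (1 - lam * gam) * |B| < (1 - lam) / 2 * D := by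
    rcases (abs_nonneg B).eq_or_lt with h0 | h0
    · rw [← h0, mul_zero]
      positivity
    · calc δ / (1 - lam * gam) * |B| < ε * ((1 - lam) / 2) * |B| := mul_lt_mul_of_pos_right ht h0
        _ = (1 - lam) / 2 * (ε * |B|) := by ring
        _ ≤ (1 - lam) / 2 * D := mul_le_mul_of_nonneg_left (hdom θ) (by positivity)
  linarith
end
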